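/- The maximum number of triples in a Berge-K4-free triple system on a 5-element vertex set is 5: every Berge-K4-free triple system on 5 vertices has at most 5 triples, and there is a triple system on 5 vertices with 5 triples that is Berge-K4-free. -/

import Mathlib

/-- `HasBergeK4 H` : `H` contains a Berge-`K₄`, i.e. four distinct vertices
`v₁, v₂, v₃, v₄` and six pairwise distinct triples `e_{ij} ∈ H` with
`{vᵢ, vⱼ} ⊆ e_{ij}` for every `1 ≤ i < j ≤ 4`. -/
def HasBergeK4 {V : Type*} [DecidableEq V] (H : Finset (Finset V)) : Prop :=
  ∃ v₁ v₂ v₃ v₄ : V, ∃ e₁₂ e₁₃ e₁₄ e₂₃ e₂₄ e₃₄ : Finset V,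
    v₁ ≠ v₂ ∧ v₁ ≠ v₃ ∧ v₁ ≠ v₄ ∧ v₂ ≠ v₃ ∧ v₂ ≠ v₄ ∧ v₃ ≠ v₄ ∧
    ([e₁₂, e₁₃, e₁₄, e₂₃, e₂₄, e₃₄] : List (Finset V)).Nodup ∧
    e₁₂ ∈ H ∧ e₁₃ ∈ H ∧ e₁₄ ∈ H ∧ e₂₃ ∈ H ∧ e₂₄ ∈ H ∧ e₃₄ ∈ H ∧
    {v₁, v₂} ⊆ e₁₂ ∧ {v₁, v₃} ⊆ e₁₃ ∧ {v₁, v₄} ⊆ e₁₄ ∧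
    {v₂, v₃} ⊆ e₂₃ ∧ {v₂, v₄} ⊆ e₂₄ ∧ {v₃, v₄} ⊆ e₃₄

/-- A Berge-`K₄` survives adding triples. -/
theorem HasBergeK4.mono {V : Type*} [DecidableEq V] {H K : Finset (Finset V)} (hHK : H ⊆ K)
    (h : HasBergeK4 H) : HasBergeK4 K := by
  obtain ⟨v₁, v₂, v₃, v₄, e₁₂, e₁₃, e₁₄, e₂₃, e₂₄, e₃₄, h₁, h₂, h₃, h₄, h₅, h₆, hnd,
    m₁, m₂, m₃, m₄, m₅, m₆, hs⟩ := h
  exact ⟨v₁, v₂, v₃, v₄, e₁₂, e₁₃, e₁₄, e₂₃, e₂₄, e₃₄, h₁, h₂, h₃, h₄, h₅, h₆, hnd,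
    hHK m₁, hHK m₂, hHK m₃, hHK m₄, hHK m₅, hHK m₆, hs⟩

/-- A Berge-`K₄` is preserved by injective relabelling of the vertices. -/
theorem HasBergeK4.map {V W : Type*} [DecidableEq V] [DecidableEq W] {H : Finset (Finset V)}
    (f : V ↪ W) (h : HasBergeK4 H) : HasBergeK4 (H.map (Finset.mapEmbedding f).toEmbedding) := by
  obtain ⟨v₁, v₂, v₃, v₄, e₁₂, e₁₃, e₁₄, e₂₃, e₂₄, e₃₄, h₁, h₂, h₃, h₄, h₅, h₆, hnd,
    m₁, m₂, m₃, m₄, m₅, m₆, s₁, s₂, s₃, s₄, s₅, s₆⟩ := h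
  have hm {e : Finset V} (he : e ∈ H) : e.map f ∈ H.map (Finset.mapEmbedding f).toEmbedding :=
    Finset.mem_map_of_mem (Finset.mapEmbedding f).toEmbedding he
  have hs {v w : V} {e : Finset V} (he : {v, w} ⊆ e) : {f v, f w} ⊆ e.map f := by
    simpa [Finset.insert_subset_iff] using he
  exact ⟨f v₁, f v₂, f v₃, f v₄, e₁₂.map f, e₁₃.map f, e₁₄.map f, e₂₃.map f, e₂₄.map f, e₃₄.map f,
    f.injective.ne h₁, f.injective.ne h₂, f.injective.ne h₃, f.injective.ne h₄,
    f.injective.ne h₅, f.injective.ne h₆, hnd.map (Finset.map_injective f),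
    hm m₁, hm m₂, hm m₃, hm m₄, hm m₅, hm m₆, hs s₁, hs s₂, hs s₃, hs s₄, hs s₅, hs s₆⟩

/-- A triple system with a Berge-`K₄` has at least six triples. -/
theorem HasBergeK4.six_le_card {V : Type*} [DecidableEq V] {H : Finset (Finset V)}
    (h : HasBergeK4 H) : 6 ≤ H.card := by
  obtain ⟨_, _, _, _, e₁₂, e₁₃, e₁₄, e₂₃, e₂₄, e₃₄, _, _, _, _, _, _, hnd,
    m₁, m₂, m₃, m₄, m₅, m₆, _⟩ := h
  rw [← show ([e₁₂, e₁₃, e₁₄, e₂₃, e₂₄, e₃₄].toFinset).card = 6 from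
    List.toFinset_card_of_nodup hnd]
  apply Finset.card_le_card
  intro e he
  simp only [List.mem_toFinset, List.mem_cons, List.not_mem_nil, or_false] at he
  rcases he with rfl | rfl | rfl | rfl | rfl | rfl <;> assumption

/-- The triples in `Fin 5`, encoded as bit masks. -/
def tripleMasks : List ℕ := [7, 11, 13, 14, 19, 21, 22, 25, 26, 28]

/-- The set of positions of the nonzero bits of `n` below `2 ^ 5`. -/
def bitSet (n : ℕ) : Finset (Fin 5) := {i | n.testBit i}

theorem mem_bitSet {n : ℕ} {i : Fin 5} : i ∈ bitSet n ↔ n.testBit i := by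
  simp [bitSet]

theorem nodup_map_bitSet : (tripleMasks.map bitSet).Nodup := by
  decide +kernel

theorem mem_map_bitSet : ∀ t : Finset (Fin 5), t.card = 3 → t ∈ tripleMasks.map bitSet := by
  decide +kernel

set_option synthInstance.maxSize 2000 in
/-- In every system of six triples on `Fin 5`, some four vertices (all but `v`) have their six
pairs covered by distinct triples; the clauses are ordered so that the search backtracks early. -/
theorem exists_distinct_cover_of_six :
    ∀ S ∈ tripleMasks.sublistsLen 6, ∃ v : Fin 5,
      ∃ a ∈ S, (a.testBit (v.succAbove 0) ∧ a.testBit (v.succAbove 1)) ∧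
      ∃ b ∈ S, (b.testBit (v.succAbove 0) ∧ b.testBit (v.succAbove 2) ∧ a ≠ b) ∧
      ∃ c ∈ S, (c.testBit (v.succAbove 0) ∧ c.testBit (v.succAbove 3) ∧ a ≠ c ∧ b ≠ c) ∧
      ∃ d ∈ S, (d.testBit (v.succAbove 1) ∧ d.testBit (v.succAbove 2) ∧
        a ≠ d ∧ b ≠ d ∧ c ≠ d) ∧
      ∃ e ∈ S, (e.testBit (v.succAbove 1) ∧ e.testBit (v.succAbove 3) ∧
        a ≠ e ∧ b ≠ e ∧ c ≠ e ∧ d ≠ e) ∧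
      ∃ f ∈ S, f.testBit (v.succAbove 2) ∧ f.testBit (v.succAbove 3) ∧
        a ≠ f ∧ b ≠ f ∧ c ≠ f ∧ d ≠ f ∧ e ≠ f := by
  decide +kernel

/-- Six triples on `Fin 5` always contain a Berge-`K₄`. -/
theorem hasBergeK4_of_six {H : Finset (Finset (Fin 5))} (h3 : ∀ t ∈ H, t.card = 3)
    (h6 : H.card = 6) : HasBergeK4 H := by
  let S := tripleMasks.filter (bitSet · ∈ H)
  have hmap : S.map bitSet = (tripleMasks.map bitSet).filter (· ∈ H) := by
    simp [S, List.filter_map, Function.comp_def]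
  have hnd : (S.map bitSet).Nodup := hmap ▸ nodup_map_bitSet.filter _
  have hH : (S.map bitSet).toFinset = H := by
    ext t
    rw [hmap, List.mem_toFinset, List.mem_filter, decide_eq_true_iff]
    exact ⟨And.right, fun ht => ⟨mem_map_bitSet t (h3 t ht), ht⟩⟩
  have hlen : S.length = 6 := by
    rw [← List.length_map bitSet, ← List.toFinset_card_of_nodup hnd, hH, h6]
  have hne {a b : ℕ} (ha : a ∈ S) (hb : b ∈ S) (hab : a ≠ b) : bitSet a ≠ bitSet b :=
    fun h => hab (List.inj_on_of_nodup_map hnd ha hb h)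
  have hmem {a : ℕ} (ha : a ∈ S) : bitSet a ∈ H := by
    simpa using (List.mem_filter.1 ha).2
  have hpair {a : ℕ} {v w : Fin 5} (hv : a.testBit v) (hw : a.testBit w) :
      {v, w} ⊆ bitSet a := by
    simp [Finset.insert_subset_iff, mem_bitSet, hv, hw]
  obtain ⟨v, a, ha, ⟨a₀, a₁⟩, b, hb, ⟨b₀, b₂, hab⟩, c, hc, ⟨c₀, c₃, hac, hbc⟩,
    d, hd, ⟨d₁, d₂, had, hbd, hcd⟩, e, he, ⟨e₁, e₃, hae, hbe, hce, hde⟩,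
    f, hf, f₂, f₃, haf, hbf, hcf, hdf, hef⟩ := exists_distinct_cover_of_six S
      (List.mem_sublistsLen.2 ⟨List.filter_sublist, hlen⟩)
  refine ⟨v.succAbove 0, v.succAbove 1, v.succAbove 2, v.succAbove 3,
    bitSet a, bitSet b, bitSet c, bitSet d, bitSet e, bitSet f, ?_, ?_, ?_, ?_, ?_, ?_, ?_,
    hmem ha, hmem hb, hmem hc, hmem hd, hmem he, hmem hf, hpair a₀ a₁, hpair b₀ b₂,
    hpair c₀ c₃, hpair d₁ d₂, hpair e₁ e₃, hpair f₂ f₃⟩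
  any_goals exact Fin.succAbove_right_injective.ne (by decide)
  simp [hne ha hb hab, hne ha hc hac, hne ha hd had, hne ha he hae, hne ha hf haf, hne hb hc hbc,
    hne hb hd hbd, hne hb he hbe, hne hb hf hbf, hne hc hd hcd, hne hc he hce, hne hc hf hcf,
    hne hd he hde, hne hd hf hdf, hne he hf hef]

/-- The maximum number of triples in a Berge-`K₄`-free triple
system on a 5-element vertex set is `5`. -/
theorem turan_bergeK4_five
    (V : Type*) [DecidableEq V] [Fintype V] (hV : Fintype.card V = 5) :
    (∀ H : Finset (Finset V), (∀ t ∈ H, t.card = 3) → ¬ HasBergeK4 H →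
      H.card ≤ 5) ∧
    (∃ H : Finset (Finset V), (∀ t ∈ H, t.card = 3) ∧ ¬ HasBergeK4 H ∧
      H.card = 5) := by
  constructor
  · intro H h3 hfree
    by_contra! hlt
    obtain ⟨K, hKH, hK⟩ := Finset.exists_subset_card_eq (show 6 ≤ H.card from hlt)
    let g : V ≃ Fin 5 := Fintype.equivFinOfCardEq hV
    have hbig : HasBergeK4 (K.map (Finset.mapEmbedding g.toEmbedding).toEmbedding) := by
      refine hasBergeK4_of_six (fun t ht => ?_) (by simpa using hK)
      obtain ⟨s, hs, rfl⟩ := Finset.mem_map.1 ht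
      simpa using h3 s (hKH hs)
    refine hfree ((hbig.map g.symm.toEmbedding).mono fun t ht => hKH ?_)
    obtain ⟨s, hs, rfl⟩ := Finset.mem_map.1 ht
    obtain ⟨r, hr, rfl⟩ := Finset.mem_map.1 hs
    simpa [Finset.map_map] using hr
  · obtain ⟨H, hH, hcard⟩ := Finset.exists_subset_card_eq
      (show 5 ≤ ((Finset.univ : Finset V).powersetCard 3).card by
        rw [Finset.card_powersetCard, Finset.card_univ, hV]; decide)
    refine ⟨H, fun t ht => (Finset.mem_powersetCard.1 (hH ht)).2, fun h => ?_, hcard⟩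
    have := h.six_le_card
    omega
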